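/- arXiv:2203.14689 — 3 statements merged into one kernel-verified Lean document; each statement's English description precedes it below -/
import Mathlib

section
/- Let 𝕜 be ℝ or ℂ, let A be a finite-dimensional 𝕜-algebra (not necessarily associative, commutative, or unital), and let s be a vector-space seminorm on A. Then there exists M > 0 such that s(a b) ≤ M s(a) s(b) for all a, b ∈ A (i.e., Ms is an algebra seminorm) if and only if the kernel K = {a ∈ A : s(a) = 0} of s is a two-sided ideal of A, i.e., x a ∈ K and a x ∈ K for every a ∈ K and every x ∈ A. -/
/-- A bilinear map between seminormed spaces with finite-dimensional domains is bounded as soon as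
it vanishes in seminorm whenever one of its arguments does. -/
theorem LinearMap.exists_bound_of_norm_eq_zero {𝕜 E F G : Type*} [RCLike 𝕜]
    [SeminormedAddCommGroup E] [NormedSpace 𝕜 E] [FiniteDimensional 𝕜 E]
    [SeminormedAddCommGroup F] [NormedSpace 𝕜 F] [FiniteDimensional 𝕜 F]
    [SeminormedAddCommGroup G] [NormedSpace 𝕜 G] (f : E →ₗ[𝕜] F →ₗ[𝕜] G)
    (hleft : ∀ x, ‖x‖ = 0 → ∀ y, ‖f x y‖ = 0) (hright : ∀ y, ‖y‖ = 0 → ∀ x, ‖f x y‖ = 0) :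
    ∃ M > 0, ∀ x y, ‖f x y‖ ≤ M * ‖x‖ * ‖y‖ := by
  have : FiniteDimensional 𝕜 (SeparationQuotient E) :=
    Module.Finite.of_surjective (SeparationQuotient.mkCLM 𝕜 E).toLinearMap
      SeparationQuotient.surjective_mk
  have : FiniteDimensional 𝕜 (SeparationQuotient F) :=
    Module.Finite.of_surjective (SeparationQuotient.mkCLM 𝕜 F).toLinearMap
      SeparationQuotient.surjective_mk
  let σE := (SeparationQuotient.outCLM 𝕜 E).toLinearMap
  let σF := (SeparationQuotient.outCLM 𝕜 F).toLinearMap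
  let g : SeparationQuotient E →ₗ[𝕜] SeparationQuotient F →ₗ[𝕜] SeparationQuotient G :=
    (f.compl₁₂ σE σF).compr₂ (SeparationQuotient.mkCLM 𝕜 G).toLinearMap
  let B := g.toContinuousBilinearMap
  have hE (x : E) : ‖x - σE (.mk x)‖ = 0 := by
    rw [← SeparationQuotient.norm_mk, SeparationQuotient.mk_sub]
    simp [σE]
  have hF (y : F) : ‖y - σF (.mk y)‖ = 0 := by
    rw [← SeparationQuotient.norm_mk, SeparationQuotient.mk_sub]
    simp [σF]
  refine ⟨‖B‖ + 1, by positivity, fun x y ↦ ?_⟩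
  have hB : ‖f (σE (.mk x)) (σF (.mk y))‖ ≤ ‖B‖ * ‖x‖ * ‖y‖ := by
    simpa [B, g] using B.le_opNorm₂ (.mk x) (.mk y)
  calc ‖f x y‖
      = ‖f (x - σE (.mk x)) y + f (σE (.mk x)) (y - σF (.mk y))
          + f (σE (.mk x)) (σF (.mk y))‖ := by simp
    _ ≤ ‖f (x - σE (.mk x)) y‖ + ‖f (σE (.mk x)) (y - σF (.mk y))‖
          + ‖f (σE (.mk x)) (σF (.mk y))‖ := norm_add₃_le
    _ = ‖f (σE (.mk x)) (σF (.mk y))‖ := by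
        rw [hleft _ (hE x), hright _ (hF y), zero_add, zero_add]
    _ ≤ ‖B‖ * ‖x‖ * ‖y‖ := hB
    _ ≤ (‖B‖ + 1) * ‖x‖ * ‖y‖ := by gcongr; simp

/-- For a vector-space seminorm `s` on a finite-dimensional real or complex
(not necessarily associative/commutative/unital) algebra, some positive
multiple `M • s` is an algebra seminorm if and only if the kernel of `s` is a
two-sided ideal. -/
theorem finiteDimensional_seminorm_submultiplicative_iff_kernel_ideal
    (𝕜 : Type*) [RCLike 𝕜] (A : Type*)
    [NonUnitalNonAssocRing A] [Module 𝕜 A]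
    [SMulCommClass 𝕜 A A] [IsScalarTower 𝕜 A A]
    [FiniteDimensional 𝕜 A]
    (s : A → ℝ)
    (hsadd : ∀ a b : A, s (a + b) ≤ s a + s b)
    (hssmul : ∀ (c : 𝕜) (a : A), s (c • a) = ‖c‖ * s a) :
    (∃ M > (0 : ℝ), ∀ a b : A, s (a * b) ≤ M * s a * s b) ↔
    (∀ a : A, s a = 0 → ∀ x : A, s (x * a) = 0 ∧ s (a * x) = 0) := by
  let p : Seminorm 𝕜 A := .of s hsadd hssmul
  have hnonneg (a : A) : 0 ≤ s a := apply_nonneg p a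
  constructor
  · rintro ⟨M, -, hM⟩ a ha x
    have hxa := hM x a
    have hax := hM a x
    rw [ha, mul_zero] at hxa
    rw [ha, mul_zero, zero_mul] at hax
    exact ⟨hxa.antisymm (hnonneg _), hax.antisymm (hnonneg _)⟩
  · intro h
    let : SeminormedAddCommGroup A := p.toAddGroupSeminorm.toSeminormedAddCommGroup
    let : NormedSpace 𝕜 A := ⟨fun c a ↦ (hssmul c a).le⟩
    exact (LinearMap.mul 𝕜 A).exists_bound_of_norm_eq_zero
      (fun a ha x ↦ (h a ha x).2) (fun a ha x ↦ (h a ha x).1)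
end

section
/- Let 𝕜 be ℝ or ℂ, let A be a 𝕜-algebra (not necessarily associative, commutative, unital, or finite-dimensional), and let s be a vector-space seminorm on A whose kernel K = {a ∈ A : s(a) = 0} is a two-sided ideal of A of finite codimension (i.e., the quotient space A/K is finite-dimensional). Then there exists M > 0 such that s(a b) ≤ M s(a) s(b) for all a, b ∈ A, i.e., Ms is an algebra seminorm on A. -/
/-- A bilinear map between finite-dimensional normed spaces is bounded. -/
theorem LinearMap.exists_pos_bound_of_finiteDimensional₂ {𝕜 E F G : Type*}
    [NontriviallyNormedField 𝕜] [CompleteSpace 𝕜]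
    [NormedAddCommGroup E] [NormedSpace 𝕜 E] [FiniteDimensional 𝕜 E]
    [NormedAddCommGroup F] [NormedSpace 𝕜 F] [FiniteDimensional 𝕜 F]
    [SeminormedAddCommGroup G] [NormedSpace 𝕜 G] (B : E →ₗ[𝕜] F →ₗ[𝕜] G) :
    ∃ M > (0 : ℝ), ∀ x y, ‖B x y‖ ≤ M * ‖x‖ * ‖y‖ := by
  let T : E →L[𝕜] F →L[𝕜] G :=
    LinearMap.toContinuousLinearMap (LinearMap.toContinuousLinearMap.toLinearMap ∘ₗ B)
  refine ⟨‖T‖ + 1, by positivity, fun x y => (T.le_opNorm₂ x y).trans ?_⟩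
  gcongr
  linarith

/-- A seminorm takes the same value at points whose difference lies in its kernel. -/
theorem Seminorm.eq_of_map_sub_eq_zero {𝕜 E : Type*} [SeminormedRing 𝕜] [AddCommGroup E]
    [Module 𝕜 E] (p : Seminorm 𝕜 E) {a b : E} (h : p (a - b) = 0) : p a = p b := by
  have := abs_sub_map_le_sub p a b
  rw [h] at this
  exact sub_eq_zero.1 (abs_nonpos_iff.1 this)

/-- If the kernel of a vector-space seminorm `s` on a real or complex
(not necessarily associative/commutative/unital/finite-dimensional) algebra is
a two-sided ideal of finite codimension, then some positive multiple `M • s`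
is an algebra seminorm. -/
theorem seminorm_submultiplicative_of_kernel_ideal_finite_codim
    (𝕜 : Type*) [RCLike 𝕜] (A : Type*)
    [NonUnitalNonAssocRing A] [Module 𝕜 A]
    [SMulCommClass 𝕜 A A] [IsScalarTower 𝕜 A A]
    (s : A → ℝ)
    (hsadd : ∀ a b : A, s (a + b) ≤ s a + s b)
    (hssmul : ∀ (c : 𝕜) (a : A), s (c • a) = ‖c‖ * s a)
    (K : Submodule 𝕜 A)
    (hK : ∀ a : A, a ∈ K ↔ s a = 0)
    (hIdeal : ∀ a ∈ K, ∀ x : A, x * a ∈ K ∧ a * x ∈ K)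
    (hcodim : FiniteDimensional 𝕜 (A ⧸ K)) :
    ∃ M > (0 : ℝ), ∀ a b : A, s (a * b) ≤ M * s a * s b := by
  let p : Seminorm 𝕜 A := Seminorm.of s hsadd hssmul
  have eq_of_sub_mem {a b : A} (h : a - b ∈ K) : s a = s b :=
    p.eq_of_map_sub_eq_zero ((hK _).1 h)
  obtain ⟨g, hg⟩ := K.mkQ.exists_rightInverse_of_surjective K.range_mkQ
  have mk_g (q : A ⧸ K) : K.mkQ (g q) = q := LinearMap.congr_fun hg q
  have g_sub_mem (a : A) : a - g (K.mkQ a) ∈ K := by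
    rw [← Submodule.Quotient.mk_eq_zero, ← K.mkQ_apply, map_sub, mk_g, sub_self]
  let _ : Norm (A ⧸ K) := ⟨fun q => s (g q)⟩
  have core : NormedSpace.Core 𝕜 (A ⧸ K) :=
    { norm_nonneg := fun q => apply_nonneg p (g q)
      norm_smul := fun c q => by
        change s (g (c • q)) = ‖c‖ * s (g q)
        rw [map_smul, hssmul]
      norm_triangle := fun q r => by
        change s (g (q + r)) ≤ s (g q) + s (g r)
        rw [map_add]
        exact hsadd _ _
      norm_eq_zero_iff := fun q => by
        change s (g q) = 0 ↔ q = 0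
        rw [← hK, ← Submodule.Quotient.mk_eq_zero, ← K.mkQ_apply, mk_g] }
  let _ : NormedAddCommGroup (A ⧸ K) := NormedAddCommGroup.ofCore core
  let _ : NormedSpace 𝕜 (A ⧸ K) := NormedSpace.ofCore core
  have norm_mk (a : A) : ‖K.mkQ a‖ = s a := (eq_of_sub_mem (g_sub_mem a)).symm
  obtain ⟨M, hM, hB⟩ :=
    (((LinearMap.mul 𝕜 A).compl₁₂ g g).compr₂ K.mkQ).exists_pos_bound_of_finiteDimensional₂
  refine ⟨M, hM, fun a b => ?_⟩
  have mul_sub_mem : a * b - g (K.mkQ a) * g (K.mkQ b) ∈ K := by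
    rw [← sub_add_sub_cancel _ (g (K.mkQ a) * b), ← sub_mul, ← mul_sub]
    exact K.add_mem (hIdeal _ (g_sub_mem a) _).2 (hIdeal _ (g_sub_mem b) _).1
  have h := hB (K.mkQ a) (K.mkQ b)
  rw [LinearMap.compr₂_apply, LinearMap.compl₁₂_apply, LinearMap.mul_apply', norm_mk, norm_mk,
    norm_mk] at h
  exact (eq_of_sub_mem mul_sub_mem).trans_le h
end

section
/- Let n ≥ 1, let M be an n × n matrix with entries in the real quaternions ℍ, and let q ∈ ℍ satisfy q·q = −1. Then M has a right eigenvalue in the copy of the complex numbers spanned by 1 and q: there exist real numbers x, y and a nonzero column vector X = (X₁, …, Xₙ) ∈ ℍⁿ such that ∑_{j=1}^{n} M_{ij} · X_j = X_i · (x•1 + y•q) for every i. -/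
/-- Every square quaternion matrix has a right eigenvalue in any copy of the
complex numbers inside the quaternions: the copy spanned by `1` and any `q`
with `q * q = -1`. -/
theorem quaternion_matrix_has_right_eigenvalue_in_complex_copy
    (n : ℕ) (hn : 1 ≤ n) (M : Matrix (Fin n) (Fin n) (Quaternion ℝ))
    (q : Quaternion ℝ) (hq : q * q = -1) :
    ∃ (x y : ℝ) (X : Fin n → Quaternion ℝ), X ≠ 0 ∧
      ∀ i : Fin n,
        ∑ j : Fin n, M i j * X j = X i * (x • (1 : Quaternion ℝ) + y • q) := by
  have : Nonempty (Fin n) := ⟨⟨0, hn⟩⟩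
  -- `ℂ` acts on `ℍⁿ` on the right through the embedding sending `I` to `q`.
  let φ : ℂ →ₐ[ℝ] (Quaternion ℝ)ᵐᵒᵖ :=
    Complex.lift ⟨MulOpposite.op q, by rw [← MulOpposite.op_mul, hq]; rfl⟩
  have φ_apply (z : ℂ) : φ z = MulOpposite.op (z.re • (1 : Quaternion ℝ) + z.im • q) := by
    simp [φ, Complex.liftAux_apply, Algebra.algebraMap_eq_smul_one]
  let : Module ℂ (Fin n → Quaternion ℝ) := Module.compHom _ φ.toRingHom
  have smul_def (z : ℂ) (X : Fin n → Quaternion ℝ) (i : Fin n) :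
      (z • X) i = X i * (z.re • (1 : Quaternion ℝ) + z.im • q) := by
    change (φ z • X) i = _
    rw [φ_apply, Pi.smul_apply, op_smul_eq_mul]
  have : IsScalarTower ℝ ℂ (Fin n → Quaternion ℝ) := ⟨fun r z X => by
    ext1 i
    rw [Pi.smul_apply, smul_def, smul_def, ← mul_smul_comm, smul_add, smul_smul, smul_smul]
    simp⟩
  have : Module.Finite ℂ (Fin n → Quaternion ℝ) :=
    Module.Finite.of_restrictScalars_finite ℝ ℂ _
  let T : Module.End ℂ (Fin n → Quaternion ℝ) :=
    { toFun := fun X => M.mulVec X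
      map_add' := M.mulVec_add
      map_smul' := fun z X => by
        ext1 i
        simp only [RingHom.id_apply, smul_def, Matrix.mulVec, dotProduct, Finset.sum_mul,
          mul_assoc] }
  obtain ⟨z, hz⟩ := Module.End.exists_eigenvalue T
  obtain ⟨X, hX⟩ := hz.exists_hasEigenvector
  refine ⟨z.re, z.im, X, hX.2, fun i => ?_⟩
  rw [← smul_def, ← hX.apply_eq_smul]
  rfl
end
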